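/- Let f : (a,b) → ℝ be twice continuously differentiable. If f is operator convex of order n, then for all t₁,…,t_n ∈ (a,b), the matrix [Δ²f(t_i, t_j, t₁)]_{i,j=1}^n of second divided differences is positive semi-definite. -/

import Mathlib

open Set
open scoped ComplexOrder

/-- Apply a real function to a Hermitian matrix via its spectral decomposition. -/
noncomputable def hermApply {n : ℕ} (f : ℝ → ℝ) (A : Matrix (Fin n) (Fin n) ℂ)
    (hA : A.IsHermitian) : Matrix (Fin n) (Fin n) ℂ :=
  (hA.eigenvectorUnitary : Matrix (Fin n) (Fin n) ℂ) *
    Matrix.diagonal (fun i => (f (hA.eigenvalues i) : ℂ)) *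
    star (hA.eigenvectorUnitary : Matrix (Fin n) (Fin n) ℂ)

/-- First divided difference. -/
noncomputable def dd (f : ℝ → ℝ) (s t : ℝ) : ℝ :=
  if s = t then deriv f s else (f t - f s) / (t - s)

/-- Second divided difference (values at repeated points taken as limits). -/
noncomputable def dd2 (f : ℝ → ℝ) (r s t : ℝ) : ℝ :=
  dd (fun u => dd f r u) s t

open Filter Topology

lemma dd_eq_dslope (f : ℝ → ℝ) (s t : ℝ) : dd f s t = dslope f s t := by
  unfold dd
  split_ifs with h
  · subst h; simp
  · rw [dslope_of_ne _ (Ne.symm h), slope_def_field]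

lemma dd2_eq_dslope (f : ℝ → ℝ) (r s t : ℝ) : dd2 f r s t = dslope (dslope f r) s t := by
  unfold dd2
  rw [dd_eq_dslope]
  congr 1
  funext u
  exact dd_eq_dslope f r u

lemma dd_mul (f : ℝ → ℝ) (s t : ℝ) : (t - s) * dd f s t = f t - f s := by
  rw [dd_eq_dslope]; simpa using sub_smul_dslope f s t

lemma dd2_mul (f : ℝ → ℝ) (r s t : ℝ) : (t - s) * dd2 f r s t = dd f r t - dd f r s :=
  dd_mul (fun u => dd f r u) s t

lemma dd_comm (f : ℝ → ℝ) (s t : ℝ) : dd f s t = dd f t s := by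
  unfold dd
  by_cases h : s = t
  · simp [h]
  · rw [if_neg h, if_neg (Ne.symm h), ← neg_sub (f s), ← neg_sub s, neg_div_neg_eq]

lemma dd2_comm_right (f : ℝ → ℝ) (r s t : ℝ) : dd2 f r s t = dd2 f r t s := dd_comm _ s t

/-- value of `dd2 f t r r` -/
lemma dd2_rep (f : ℝ → ℝ) (r t : ℝ) (h : r ≠ t) (hf : DifferentiableAt ℝ f r) :
    dd2 f t r r = dd2 f r r t := by
  rw [dd2_eq_dslope, dslope_same, (dslope_eventuallyEq_slope_of_ne f h).deriv_eq]
  have hs : slope f t = fun u => (f u - f t) / (u - t) := by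
    funext u; exact slope_def_field f t u
  have h1 : HasDerivAt (fun u => (f u - f t) / (u - t))
      ((deriv f r * (r - t) - (f r - f t) * 1) / (r - t) ^ 2) r :=
    (hf.hasDerivAt.sub_const _).div ((hasDerivAt_id r).sub_const t) (sub_ne_zero.2 h)
  rw [hs, h1.deriv]
  unfold dd2 dd
  simp only [if_neg h, if_true]
  have h2 : r - t ≠ 0 := sub_ne_zero.2 h
  have h3 : t - r ≠ 0 := sub_ne_zero.2 h.symm
  rw [div_sub' h3, div_div, div_eq_div_iff (by positivity) (by positivity)]
  ring

lemma dd2_comm_left (f : ℝ → ℝ) (r s t : ℝ) (hr : DifferentiableAt ℝ f r)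
    (hs : DifferentiableAt ℝ f s) : dd2 f r s t = dd2 f s r t := by
  by_cases hrs : r = s
  · rw [hrs]
  by_cases hrt : r = t
  · subst hrt
    rw [dd2_comm_right, dd2_rep f r s hrs hr]
  by_cases hst : s = t
  · subst hst
    rw [dd2_comm_right f s r s]
    exact dd2_rep f s r (Ne.symm hrs) hs
  have h1 : r - s ≠ 0 := sub_ne_zero.2 hrs
  have h2 : r - t ≠ 0 := sub_ne_zero.2 hrt
  have h3 : s - t ≠ 0 := sub_ne_zero.2 hst
  have h1' : s - r ≠ 0 := sub_ne_zero.2 (Ne.symm hrs)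
  have h2' : t - r ≠ 0 := sub_ne_zero.2 (Ne.symm hrt)
  have h3' : t - s ≠ 0 := sub_ne_zero.2 (Ne.symm hst)
  unfold dd2 dd
  simp only [if_neg hst, if_neg hrt, if_neg hrs, if_neg (Ne.symm hrs)]
  field_simp
  ring

lemma differentiableAt_dslope_self (a b : ℝ) (f : ℝ → ℝ) (hf : ContDiffOn ℝ 2 f (Ioo a b))
    (r : ℝ) (hr : r ∈ Ioo a b) : DifferentiableAt ℝ (dslope f r) r := by
  have hT := taylor_isLittleO (n := 2) (convex_Ioo a b) hr (by exact_mod_cast hf)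
  rw [nhdsWithin_eq_nhds.2 (isOpen_Ioo.mem_nhds hr)] at hT
  have hd1 : iteratedDerivWithin 1 f (Ioo a b) r = deriv f r := by
    rw [iteratedDerivWithin_one, derivWithin_of_isOpen isOpen_Ioo hr]
  set q := iteratedDerivWithin 2 f (Ioo a b) r with hq
  have key : HasDerivAt (dslope f r) (q / 2) r := by
    rw [hasDerivAt_iff_isLittleO]
    rw [Asymptotics.isLittleO_iff] at hT ⊢
    intro c hc
    filter_upwards [hT hc] with u hu
    simp only [taylorWithinEval_succ, taylor_within_zero_eval, hd1, ← hq] at hu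
    by_cases h : u = r
    · subst h; simp
    have h0 : u - r ≠ 0 := sub_ne_zero.2 h
    have hpos : 0 < ‖u - r‖ := norm_pos_iff.2 h0
    rw [dslope_of_ne _ h, slope_def_field, dslope_same]
    have e : (f u - f r) / (u - r) - deriv f r - (u - r) • (q / 2) =
      (f u - (f r + (u - r) * deriv f r + (u-r)^2 / 2 * q)) / (u - r) := by
      simp only [smul_eq_mul]; field_simp; ring
    rw [e, norm_div, div_le_iff₀ hpos, mul_assoc, ← sq, ← norm_pow]
    refine le_trans (le_of_eq ?_) hu
    congr 1
    norm_num
    left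
    ring
  exact key.differentiableAt

lemma continuousOn_dd2 (a b : ℝ) (f : ℝ → ℝ) (hf : ContDiffOn ℝ 2 f (Ioo a b))
    (r s : ℝ) (hr : r ∈ Ioo a b) (hs : s ∈ Ioo a b) :
    ContinuousOn (fun u => dd2 f r s u) (Ioo a b) := by
  have hd : DifferentiableOn ℝ f (Ioo a b) := hf.differentiableOn (by norm_num)
  have hda : ∀ x ∈ Ioo a b, DifferentiableAt ℝ f x := fun x hx =>
    hd.differentiableAt (isOpen_Ioo.mem_nhds hx)
  have e : (fun u => dd2 f r s u) = dslope (dslope f r) s := by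
    funext u; exact dd2_eq_dslope f r s u
  rw [e, continuousOn_dslope (isOpen_Ioo.mem_nhds hs),
    continuousOn_dslope (isOpen_Ioo.mem_nhds hr)]
  refine ⟨⟨hd.continuousOn, hda r hr⟩, ?_⟩
  by_cases h : s = r
  · subst h; exact differentiableAt_dslope_self a b f hf s hs
  · exact (differentiableAt_dslope_of_ne h).2 (hda s hs)

/-- the perturbed matrix -/
noncomputable def pert {n : ℕ} (t : Fin n → ℝ) (M : Matrix (Fin n) (Fin n) ℝ) (s : ℝ) :
    Matrix (Fin n) (Fin n) ℂ :=
  Matrix.of fun i j => (((if i = j then t i else 0) + s * M i j : ℝ) : ℂ)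

lemma pert_herm {n : ℕ} (t : Fin n → ℝ) (M : Matrix (Fin n) (Fin n) ℝ) (hM : ∀ i j, M i j = M j i)
    (s : ℝ) : (pert t M s).IsHermitian := by
  ext i j
  simp only [pert, Matrix.conjTranspose_apply, Matrix.of_apply, RCLike.star_def, Complex.conj_ofReal]
  rw [hM j i]
  by_cases h : i = j
  · subst h; rfl
  · rw [if_neg h, if_neg (Ne.symm h)]

lemma pert_eig {n : ℕ} (t : Fin n → ℝ) (M : Matrix (Fin n) (Fin n) ℝ) (s : ℝ)
    (h : (pert t M s).IsHermitian) (m : Fin n) :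
    ∃ k, |h.eigenvalues m - t k| ≤ |s| * ∑ i, ∑ j, |M i j| := by
  have hs := h.eigenvalues_mem_spectrum_real m
  have hs2 : ((h.eigenvalues m : ℝ) : ℂ) ∈ spectrum ℂ (pert t M s) := by
    rw [h.spectrum_eq_image_range]; exact ⟨_, ⟨m, rfl⟩, rfl⟩
  rw [← Matrix.spectrum_toLin', ← Module.End.hasEigenvalue_iff_mem_spectrum] at hs2
  obtain ⟨k, hk⟩ := eigenvalue_mem_ball hs2
  refine ⟨k, ?_⟩
  rw [mem_closedBall_iff_norm] at hk
  have e1 : ∑ j ∈ Finset.univ.erase k, ‖pert t M s k j‖ =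
      ∑ j ∈ Finset.univ.erase k, |s| * |M k j| := by
    refine Finset.sum_congr rfl fun j hj => ?_
    have : k ≠ j := (Finset.ne_of_mem_erase hj).symm
    simp [pert, this]
  have e2 : ((h.eigenvalues m : ℝ) : ℂ) - pert t M s k k =
      ((h.eigenvalues m - t k - s * M k k : ℝ) : ℂ) := by
    simp [pert]; ring
  rw [e1, e2, Complex.norm_real, Real.norm_eq_abs] at hk
  have h3 : |h.eigenvalues m - t k| ≤ |h.eigenvalues m - t k - s * M k k| + |s| * |M k k| := by
    rw [← abs_mul]
    calc _ = |(h.eigenvalues m - t k - s * M k k) + s * M k k| := by ring_nf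
      _ ≤ _ := abs_add_le _ _
  have h4 : ∑ j, |s| * |M k j| ≤ |s| * ∑ i, ∑ j, |M i j| := by
    rw [← Finset.mul_sum]
    refine mul_le_mul_of_nonneg_left ?_ (abs_nonneg s)
    exact Finset.single_le_sum (f := fun i => ∑ j, |M i j|)
      (fun i _ => Finset.sum_nonneg fun j _ => abs_nonneg _) (Finset.mem_univ k)
  rw [← Finset.add_sum_erase _ _ (Finset.mem_univ k)] at h4
  linarith

lemma hermApply_apply {n : ℕ} (f : ℝ → ℝ) (A : Matrix (Fin n) (Fin n) ℂ)
    (hA : A.IsHermitian) (i j : Fin n) : hermApply f A hA i j =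
    ∑ m, hA.eigenvectorUnitary.1 i m * f (hA.eigenvalues m) * star (hA.eigenvectorUnitary.1 j m) := by
  unfold hermApply
  rw [Matrix.mul_apply]
  refine Finset.sum_congr rfl fun m _ => ?_
  rw [Matrix.mul_diagonal, Matrix.star_apply]

lemma hermApply_eq_cfc {n : ℕ} (f : ℝ → ℝ) (A : Matrix (Fin n) (Fin n) ℂ)
    (hA : A.IsHermitian) : hermApply f A hA = cfc f A := by
  rw [hA.cfc_eq f, Matrix.IsHermitian.cfc, Unitary.conjStarAlgAut_apply]
  rfl

lemma eigvec_eq {n : ℕ} (t : Fin n → ℝ) (M : Matrix (Fin n) (Fin n) ℝ) (s : ℝ)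
    (h : (pert t M s).IsHermitian) (m j : Fin n) :
    (s : ℂ) * ∑ k, star (h.eigenvectorUnitary.1 k m) * M k j =
      (h.eigenvalues m - t j : ℝ) * star (h.eigenvectorUnitary.1 j m) := by
  have h0 : ∑ k, pert t M s j k * h.eigenvectorUnitary.1 k m =
      h.eigenvalues m * h.eigenvectorUnitary.1 j m := by
    have := congrFun (h.mulVec_eigenvectorBasis m) j
    simpa [Matrix.mulVec, dotProduct] using this
  have h1 := congrArg star h0
  have h2 : ∀ k, star (pert t M s j k) = pert t M s k j := fun k => by
    rw [← Matrix.conjTranspose_apply, h.eq]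
  generalize h.eigenvectorUnitary.1 = U at *
  generalize h.eigenvalues m = μ at *
  rw [star_sum] at h1
  simp only [star_mul, h2] at h1
  have h3 : ∀ k, star (U k m) * pert t M s k j =
      (if k = j then star (U k m) * t k else 0) + s * (star (U k m) * M k j) := by
    intro k
    simp only [pert, Matrix.of_apply]
    split_ifs <;> push_cast <;> ring
  simp only [h3, Finset.sum_add_distrib, Finset.sum_ite_eq', Finset.mem_univ, if_true,
    ← Finset.mul_sum] at h1
  have h4 : star (μ : ℂ) = μ := Complex.conj_ofReal μ
  rw [h4] at h1
  push_cast
  linear_combination h1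

lemma unit_sum {n : ℕ} (A : Matrix (Fin n) (Fin n) ℂ) (h : A.IsHermitian) (i k : Fin n) :
    ∑ m, h.eigenvectorUnitary.1 i m * star (h.eigenvectorUnitary.1 k m) = if i = k then 1 else 0 := by
  have := congrFun (congrFun (Unitary.coe_mul_star_self h.eigenvectorUnitary) i) k
  rw [Matrix.mul_apply, Matrix.one_apply] at this
  simpa [Matrix.star_apply] using this

/-- exact second order expansion -/
lemma expansion {n : ℕ} (f : ℝ → ℝ) (t : Fin n → ℝ) (M : Matrix (Fin n) (Fin n) ℝ) (s : ℝ)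
    (h : (pert t M s).IsHermitian) (i j : Fin n) :
    hermApply f (pert t M s) h i j = (if i = j then (f (t j) : ℂ) else 0)
      + s * (M i j * dd f (t j) (t i) : ℝ)
      + s ^ 2 * ∑ k, ∑ l, M k j * M l k *
          hermApply (fun u => dd2 f (t j) (t k) u) (pert t M s) h i l := by
  set U := h.eigenvectorUnitary.1 with hU
  set μ := h.eigenvalues with hμ
  have E : ∀ m, (f (μ m) : ℂ) * star (U j m) = f (t j) * star (U j m)
      + s * ∑ k, star (U k m) * (M k j * dd f (t j) (t k) : ℝ)
      + s ^ 2 * ∑ k, ∑ l, M k j * M l k * dd2 f (t j) (t k) (μ m) * star (U l m) := by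
    intro m
    have A1 : ∀ j, (s : ℂ) * ∑ k, star (U k m) * M k j = (μ m - t j : ℝ) * star (U j m) :=
      fun j => eigvec_eq t M s h m j
    have d1 := congrArg (fun x : ℝ => (x : ℂ)) (dd_mul f (t j) (μ m))
    have d2 : ∀ k, _ := fun k => congrArg (fun x : ℝ => (x : ℂ)) (dd2_mul f (t j) (t k) (μ m))
    push_cast at d1 d2 A1 ⊢
    have : (f (μ m) : ℂ) * star (U j m) = f (t j) * star (U j m) +
        dd f (t j) (μ m) * ((μ m - t j) * star (U j m)) := by
      linear_combination -star (U j m) * d1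
    rw [this, ← A1 j, add_assoc]
    congr 1
    rw [Finset.mul_sum, Finset.mul_sum, Finset.mul_sum, Finset.mul_sum, ← Finset.sum_add_distrib]
    refine Finset.sum_congr rfl fun k _ => ?_
    have e3 : ∑ l, (M k j : ℂ) * M l k * dd2 f (t j) (t k) (μ m) * star (U l m) =
        M k j * dd2 f (t j) (t k) (μ m) * ∑ l, star (U l m) * M l k := by
      rw [Finset.mul_sum]
      refine Finset.sum_congr rfl fun l _ => ?_
      ring
    rw [e3]
    linear_combination (-s * M k j * star (U k m)) * d2 k - (s * M k j * dd2 f (t j) (t k) (μ m)) * A1 k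
  have D := fun k => unit_sum _ h i k
  simp only [hermApply_apply, ← hU, ← hμ]
  simp only [mul_assoc, E, mul_add, Finset.sum_add_distrib]
  rw [← hU] at D
  congr 1
  · congr 1
    · calc _ = f (t j) * ∑ m, U i m * star (U j m) := by
            rw [Finset.mul_sum]; exact Finset.sum_congr rfl fun m _ => by ring
        _ = _ := by rw [D j]; split_ifs <;> simp
    · calc _ = s * ∑ k, (M k j * dd f (t j) (t k) : ℝ) * ∑ m, U i m * star (U k m) := by
            simp only [Finset.mul_sum]
            rw [Finset.sum_comm]
            exact Finset.sum_congr rfl fun m _ => Finset.sum_congr rfl fun k _ => by ring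
        _ = _ := by simp only [D]; simp
  · simp only [Finset.mul_sum]
    rw [Finset.sum_comm]
    refine Finset.sum_congr rfl fun k _ => ?_
    rw [Finset.sum_comm]
    refine Finset.sum_congr rfl fun l _ => Finset.sum_congr rfl fun m _ => by ring

open scoped Matrix.Norms.L2Operator in
lemma tendsto_hermApply {n : ℕ} (g : ℝ → ℝ) (t : Fin n → ℝ) (M : Matrix (Fin n) (Fin n) ℝ)
    (hM : ∀ i j, M i j = M j i) (K : Set ℝ) (hK : IsCompact K) (hg : ContinuousOn g K)
    (hsp : ∀ᶠ s in 𝓝 (0:ℝ), ∀ m, (pert_herm t M hM s).eigenvalues m ∈ K) :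
    Tendsto (fun s => hermApply g (pert t M s) (pert_herm t M hM s)) (𝓝 0)
      (𝓝 (hermApply g (pert t M 0) (pert_herm t M hM 0))) := by
  simp only [hermApply_eq_cfc]
  have hs : ∀ᶠ s in 𝓝 (0:ℝ), spectrum ℝ (pert t M s) ⊆ K := by
    filter_upwards [hsp] with s h
    rw [(pert_herm t M hM s).spectrum_real_eq_range_eigenvalues]
    rintro _ ⟨m, rfl⟩
    exact h m
  refine Filter.Tendsto.cfc hK g ?_ hs (Eventually.of_forall fun s => pert_herm t M hM s)
    hs.self_of_nhds (pert_herm t M hM 0) hg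
  have : Continuous (pert t M) := by
    refine continuous_matrix fun i j => ?_
    simp only [pert, Matrix.of_apply]
    fun_prop
  exact this.tendsto 0

lemma hermApply_zero {n : ℕ} (f : ℝ → ℝ) (t : Fin n → ℝ) (M : Matrix (Fin n) (Fin n) ℝ)
    (h : (pert t M 0).IsHermitian) (i j : Fin n) :
    hermApply f (pert t M 0) h i j = if i = j then (f (t j) : ℂ) else 0 := by
  rw [expansion]; simp

lemma exists_compact {n : ℕ} (a b : ℝ) (t : Fin n → ℝ) (ht : ∀ i, t i ∈ Ioo a b)
    (M : Matrix (Fin n) (Fin n) ℝ) (hM : ∀ i j, M i j = M j i) :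
    ∃ K : Set ℝ, IsCompact K ∧ K ⊆ Ioo a b ∧
      ∀ᶠ s in 𝓝 (0:ℝ), ∀ m, (pert_herm t M hM s).eigenvalues m ∈ K := by
  have h1 : ∀ᶠ e in 𝓝[>] (0:ℝ), ∀ i, Metric.closedBall (t i) e ⊆ Ioo a b := by
    rw [eventually_all]
    intro i
    obtain ⟨e, he, hs⟩ := Metric.nhds_basis_closedBall.mem_iff.1 (isOpen_Ioo.mem_nhds (ht i))
    filter_upwards [Ioc_mem_nhdsGT he] with e' he'
    exact (Metric.closedBall_subset_closedBall he'.2).trans hs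
  obtain ⟨e, he, hpos⟩ := (h1.and self_mem_nhdsWithin).exists
  refine ⟨⋃ i, Metric.closedBall (t i) e, isCompact_iUnion fun i => isCompact_closedBall _ _,
    iUnion_subset he, ?_⟩
  have h2 : Tendsto (fun s : ℝ => |s| * ∑ i, ∑ j, |M i j|) (𝓝 0) (𝓝 (|0| * ∑ i, ∑ j, |M i j|)) :=
    (Continuous.tendsto (by fun_prop) 0)
  rw [abs_zero, zero_mul] at h2
  filter_upwards [h2.eventually_lt_const hpos] with s hs m
  obtain ⟨k, hk⟩ := pert_eig t M s (pert_herm t M hM s) m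
  refine mem_iUnion.2 ⟨k, ?_⟩
  rw [mem_closedBall_iff_norm, Real.norm_eq_abs]
  exact hk.trans hs.le

lemma quad_re_nonneg {n : ℕ} (P : Matrix (Fin n) (Fin n) ℂ) (hP : P.PosSemidef) (x : Fin n → ℝ) :
    0 ≤ ∑ i, ∑ j, x i * x j * (P i j).re := by
  have h := (Complex.le_def.1 (hP.dotProduct_mulVec_nonneg (fun i => (x i : ℂ)))).1
  simp only [dotProduct, Matrix.mulVec, Complex.zero_re, Complex.re_sum] at h
  refine h.trans (le_of_eq ?_)
  refine Finset.sum_congr rfl fun i _ => ?_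
  simp only [Pi.star_apply, RCLike.star_def, Complex.conj_ofReal, Complex.re_ofReal_mul,
    Complex.re_sum, Complex.re_mul_ofReal, Finset.mul_sum]
  refine Finset.sum_congr rfl fun j _ => ?_
  ring

lemma quad_nonneg {n : ℕ} (a b : ℝ) (f : ℝ → ℝ)
    (hf : ContDiffOn ℝ 2 f (Ioo a b))
    (hconv : ∀ (A B : Matrix (Fin n) (Fin n) ℂ)
      (hA : A.IsHermitian) (hB : B.IsHermitian),
      (∀ i, hA.eigenvalues i ∈ Ioo a b) → (∀ i, hB.eigenvalues i ∈ Ioo a b) →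
      ∀ l ∈ Icc (0:ℝ) 1, ∀ hC : (l • A + (1 - l) • B).IsHermitian,
        (l • hermApply f A hA + (1 - l) • hermApply f B hB -
          hermApply f (l • A + (1 - l) • B) hC).PosSemidef)
    (t : Fin n → ℝ) (ht : ∀ i, t i ∈ Ioo a b) (M : Matrix (Fin n) (Fin n) ℝ)
    (hM : ∀ i j, M i j = M j i) (x : Fin n → ℝ) :
    0 ≤ ∑ i, ∑ j, x i * x j * ∑ k, M k j * M i k * dd2 f (t j) (t k) (t i) := by
  obtain ⟨K, hK, hKs, hsp⟩ := exists_compact a b t ht M hM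
  set R : ℝ → ℝ := fun s => ∑ i, ∑ j, x i * x j * ∑ k, ∑ l, M k j * M l k *
    (hermApply (fun u => dd2 f (t j) (t k) u) (pert t M s) (pert_herm t M hM s) i l).re with hR
  have hR0 : R 0 = ∑ i, ∑ j, x i * x j * ∑ k, M k j * M i k * dd2 f (t j) (t k) (t i) := by
    simp only [hR, hermApply_zero]
    refine Finset.sum_congr rfl fun i _ => Finset.sum_congr rfl fun j _ => ?_
    congr 1
    refine Finset.sum_congr rfl fun k _ => ?_
    rw [Finset.sum_eq_single i]
    · simp
    · intro l _ hl; simp [Ne.symm hl]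
    · simp
  have hRt : Tendsto R (𝓝 0) (𝓝 (R 0)) := by
    refine tendsto_finsetSum _ fun i _ => tendsto_finsetSum _ fun j _ => ?_
    refine Tendsto.const_mul _ ?_
    refine tendsto_finsetSum _ fun k _ => tendsto_finsetSum _ fun l _ => ?_
    refine Tendsto.const_mul _ ?_
    have h1 := tendsto_hermApply (fun u => dd2 f (t j) (t k) u) t M hM K hK
      ((continuousOn_dd2 a b f hf _ _ (ht j) (ht k)).mono hKs) hsp
    have h2 := tendsto_pi_nhds.1 (tendsto_pi_nhds.1 h1 i) l
    exact (Complex.continuous_re.tendsto _).comp h2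
  set Q : ℝ → ℝ := fun s => ∑ i, ∑ j, x i * x j *
    (hermApply f (pert t M s) (pert_herm t M hM s) i j).re with hQ
  obtain ⟨Q0, L, hQe⟩ : ∃ Q0 L : ℝ, ∀ s, Q s = Q0 + s * L + s ^ 2 * R s := by
    refine ⟨∑ i, ∑ j, x i * x j * (if i = j then f (t j) else 0),
      ∑ i, ∑ j, x i * x j * (M i j * dd f (t j) (t i)), fun s => ?_⟩
    simp only [hQ, hR, Finset.mul_sum, ← Finset.sum_add_distrib]
    refine Finset.sum_congr rfl fun i _ => Finset.sum_congr rfl fun j _ => ?_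
    rw [expansion]
    have e1 : (if i = j then (f (t j) : ℂ) else 0) = ((if i = j then f (t j) else 0 : ℝ) : ℂ) := by
      split_ifs <;> simp
    rw [e1]
    simp only [← Complex.ofReal_pow, Complex.add_re, Complex.re_ofReal_mul, Complex.ofReal_re,
      Complex.re_sum, ← Complex.ofReal_mul, mul_add, Finset.mul_sum]
    congr 1
    · ring
    · refine Finset.sum_congr rfl fun k _ => Finset.sum_congr rfl fun l _ => ?_
      ring
  have hsp' : ∀ᶠ s in 𝓝 (0:ℝ), ∀ m, (pert_herm t M hM (-s)).eigenvalues m ∈ K := by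
    have : Tendsto (fun s : ℝ => -s) (𝓝 0) (𝓝 0) := by simpa using (continuous_neg.tendsto (0:ℝ))
    exact this.eventually hsp
  have hRt' : Tendsto (fun s => R (-s)) (𝓝 0) (𝓝 (R 0)) := by
    have : Tendsto (fun s : ℝ => -s) (𝓝 0) (𝓝 0) := by simpa using (continuous_neg.tendsto (0:ℝ))
    exact hRt.comp this
  have hpos : ∀ᶠ s in 𝓝[≠] (0:ℝ), 0 ≤ R s + R (-s) := by
    filter_upwards [nhdsWithin_le_nhds hsp, nhdsWithin_le_nhds hsp', self_mem_nhdsWithin]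
      with s h1 h2 h3
    have e : (1/2 : ℝ) • pert t M s + (1 - 1/2 : ℝ) • pert t M (-s) = pert t M 0 := by
      ext i j
      simp only [pert, Matrix.add_apply, Matrix.smul_apply, Matrix.of_apply, Complex.real_smul,
        ← Complex.ofReal_mul, ← Complex.ofReal_add]
      congr 1
      ring
    have hC : ((1/2 : ℝ) • pert t M s + (1 - 1/2 : ℝ) • pert t M (-s)).IsHermitian := by
      rw [e]; exact pert_herm t M hM 0
    have hP := hconv _ _ (pert_herm t M hM s) (pert_herm t M hM (-s)) (fun m => hKs (h1 m))
      (fun m => hKs (h2 m)) (1/2) (by norm_num) hC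
    have e2 : hermApply f _ hC = hermApply f (pert t M 0) (pert_herm t M hM 0) := by
      simp only [hermApply_eq_cfc, e]
    rw [e2] at hP
    have hq := quad_re_nonneg _ hP x
    have e3 : ∑ i, ∑ j, x i * x j * (((1/2 : ℝ) • hermApply f (pert t M s) (pert_herm t M hM s)
        + (1 - 1/2 : ℝ) • hermApply f (pert t M (-s)) (pert_herm t M hM (-s))
        - hermApply f (pert t M 0) (pert_herm t M hM 0)) i j).re
        = 1/2 * Q s + 1/2 * Q (-s) - Q 0 := by
      simp only [hQ, Finset.mul_sum, ← Finset.sum_add_distrib, ← Finset.sum_sub_distrib]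
      refine Finset.sum_congr rfl fun i _ => Finset.sum_congr rfl fun j _ => ?_
      simp only [Matrix.sub_apply, Matrix.add_apply, Matrix.smul_apply, Complex.sub_re,
        Complex.add_re, Complex.smul_re, smul_eq_mul]
      ring
    rw [e3, hQe, hQe, hQe] at hq
    have hs2 : 0 < s ^ 2 := by
      have : s ≠ 0 := h3
      positivity
    have : 0 ≤ s ^ 2 * (R s + R (-s)) := by linarith
    exact nonneg_of_mul_nonneg_right this hs2
  have := ge_of_tendsto ((hRt.add hRt').mono_left nhdsWithin_le_nhds) hpos
  rw [← hR0]
  linarith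

/-- If a `C^2` function is operator convex of order `n+1` on `(a,b)`, then the matrices
of second divided differences `[Δ²f(t i, t j, t 0)]` are positive semi-definite. -/
theorem matrixConvex_imp_dd2Matrix_posSemidef {n : ℕ} (a b : ℝ) (f : ℝ → ℝ)
    (hf : ContDiffOn ℝ 2 f (Ioo a b))
    (hconv : ∀ (A B : Matrix (Fin (n + 1)) (Fin (n + 1)) ℂ)
      (hA : A.IsHermitian) (hB : B.IsHermitian),
      (∀ i, hA.eigenvalues i ∈ Ioo a b) → (∀ i, hB.eigenvalues i ∈ Ioo a b) →
      ∀ l ∈ Icc (0:ℝ) 1, ∀ hC : (l • A + (1 - l) • B).IsHermitian,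
        (l • hermApply f A hA + (1 - l) • hermApply f B hB -
          hermApply f (l • A + (1 - l) • B) hC).PosSemidef) :
    ∀ t : Fin (n + 1) → ℝ, (∀ i, t i ∈ Ioo a b) →
      (Matrix.of fun i j => dd2 f (t i) (t j) (t 0)).PosSemidef := by
  intro t ht
  have hd : ∀ i, DifferentiableAt ℝ f (t i) := fun i =>
    (hf.differentiableOn (by norm_num)).differentiableAt (isOpen_Ioo.mem_nhds (ht i))
  have hsym : ∀ i j, dd2 f (t j) (t 0) (t i) = dd2 f (t i) (t j) (t 0) := fun i j => by
    rw [dd2_comm_right, dd2_comm_left f _ _ _ (hd j) (hd i)]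
  refine Matrix.PosSemidef.of_dotProduct_mulVec_nonneg ?_ fun c => ?_
  · ext i j
    simp only [Matrix.conjTranspose_apply, Matrix.of_apply, star_trivial]
    exact dd2_comm_left f _ _ _ (hd j) (hd i)
  set S : ℝ := ∑ i, ∑ j, c i * c j * dd2 f (t j) (t 0) (t i) with hS
  have hgoal : star c ⬝ᵥ (Matrix.of fun i j => dd2 f (t i) (t j) (t 0)).mulVec c = S := by
    simp only [dotProduct, Matrix.mulVec, Matrix.of_apply, star_trivial, hS, Finset.mul_sum, hsym]
    refine Finset.sum_congr rfl fun i _ => Finset.sum_congr rfl fun j _ => ?_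
    ring
  rw [hgoal]
  set T : ℝ := ∑ k : Fin n, c 0 * c 0 * dd2 f (t 0) (t k.succ) (t 0) with hT
  have key : ∀ e : ℝ, 0 < e → 0 ≤ S + e ^ 2 * T := by
    intro e he
    have hq := quad_nonneg a b f hf hconv t ht
      (Matrix.of fun i j => if i = 0 then (if j = 0 then 1 else e) else (if j = 0 then e else 0))
      (by intro i j; simp only [Matrix.of_apply]; split_ifs <;> rfl)
      (fun i => if i = 0 then c i else c i / e)
    refine hq.trans (le_of_eq ?_)
    have hne : e ≠ 0 := he.ne'
    have term : ∀ i j : Fin (n + 1), (if i = 0 then c i else c i / e) *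
        (if j = 0 then c j else c j / e) *
        ∑ k, (Matrix.of fun i j : Fin (n + 1) => if i = 0 then (if j = 0 then 1 else e)
            else (if j = 0 then e else 0)) k j *
          (Matrix.of fun i j : Fin (n + 1) => if i = 0 then (if j = 0 then 1 else e)
            else (if j = 0 then e else 0)) i k * dd2 f (t j) (t k) (t i) =
        c i * c j * dd2 f (t j) (t 0) (t i) +
          (if i = 0 then (if j = 0 then e ^ 2 * T else 0) else 0) := by
      intro i j
      simp only [Matrix.of_apply]
      rw [Fin.sum_univ_succ]
      by_cases hi : i = 0
      · by_cases hj : j = 0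
        · subst hi; subst hj
          simp only [if_true, Fin.succ_ne_zero, if_false, hT, Finset.mul_sum, mul_add]
          congr 1
          · ring
          · exact Finset.sum_congr rfl fun k _ => by ring
        · subst hi
          simp [hj, Fin.succ_ne_zero]
          field_simp
      · by_cases hj : j = 0
        · subst hj
          simp [hi, Fin.succ_ne_zero]
          field_simp
        · simp [hi, hj, Fin.succ_ne_zero]
          field_simp
    simp only [term, Finset.sum_add_distrib]
    simp [hS]
  have ht : Tendsto (fun e : ℝ => S + e ^ 2 * T) (𝓝[>] 0) (𝓝 (S + 0 ^ 2 * T)) :=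
    (Continuous.tendsto (by fun_prop) 0).mono_left nhdsWithin_le_nhds
  have := ge_of_tendsto ht (by filter_upwards [self_mem_nhdsWithin] with e he using key e he)
  simpa using this
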